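/- Let ν be a subnumbering of a set X and let (ℬ, β) be a Lacombe basis for (X, ν). Then the Lacombe topology (𝒯, τ) associated to (ℬ, β) makes (X, ν, 𝒯, τ), with the actual inclusion relation as formal inclusion, a Type 1 computable topological space. -/

import Mathlib

namespace T1

/-- `phi e` : the `e`-th partial computable function `ℕ ⇀ ℕ`. -/
def phi (e : ℕ) : ℕ →. ℕ :=
  Nat.Partrec.Code.eval (Denumerable.ofNat Nat.Partrec.Code e)

/-- `W e` : the `e`-th computably enumerable subset of `ℕ`. -/
def W (e : ℕ) : Set ℕ := (phi e).Dom

/-- A canonical numbering of the rationals. -/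
def ratOfNat (k : ℕ) : ℚ := (Encodable.decode (α := ℚ) k).getD 0

/-- `e` is a name of `A ⊆ X` as a `ν`-semi-decidable set (a `ν_SD,m`-name):
`phi e` halts on a `ν`-name exactly when the named point belongs to `A`. -/
def SemiDecName {X : Type*} (ν : ℕ →. X) (A : Set X) (e : ℕ) : Prop :=
  ∀ i x, x ∈ ν i → ((phi e i).Dom ↔ x ∈ A)

/-- `f : X → Y` is `(ν,μ)`-computable. -/
def Computes {X Y : Type*} (ν : ℕ →. X) (μ : ℕ →. Y) (f : X → Y) : Prop :=
  ∃ F : ℕ →. ℕ, Nat.Partrec F ∧ ∀ n x, x ∈ ν n → ∃ m ∈ F n, f x ∈ μ m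

/-- `r` is a formal inclusion relation for the naming relation `β` of a family of
subsets of `X`: reflexive (on names), transitive, and implying actual inclusion. -/
structure IsFormalIncl {X : Type*} (β : ℕ → Set X → Prop) (r : ℕ → ℕ → Prop) : Prop where
  refl : ∀ n A, β n A → r n n
  trans : ∀ a b c, r a b → r b c → r a c
  mono : ∀ n m A B, r n m → β n A → β m B → A ⊆ B

/-- Extension of a formal inclusion relation: a name vs. a sequence of names. -/
def SeqIncl (r : ℕ → ℕ → Prop) (b : ℕ) (s : ℕ → ℕ) : Prop := ∃ k, r b (s k)

/-- Extension of a formal inclusion relation: sequence vs. sequence. -/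
def SeqIncl₂ (r : ℕ → ℕ → Prop) (s t : ℕ → ℕ) : Prop := ∀ p, SeqIncl r (s p) t

/-- The equivalence induced by the extended formal inclusion on sequences. -/
def SeqEquiv (r : ℕ → ℕ → Prop) (s t : ℕ → ℕ) : Prop := SeqIncl₂ r s t ∧ SeqIncl₂ r t s

/-- A Type 1 computable topological space `(X, ν, T, τ, r)`, where `τ` is a
(single-valued) naming relation for open sets and `r` a formal inclusion relation. -/
structure IsCTS {X : Type*} (ν : ℕ →. X) (T : TopologicalSpace X)
    (τ : ℕ → Set X → Prop) (r : ℕ → ℕ → Prop) : Prop where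
  single : ∀ n A B, τ n A → τ n B → A = B
  formal : IsFormalIncl τ r
  isOpen : ∀ n A, τ n A → T.IsOpen A
  generates : T = TopologicalSpace.generateFrom {A | ∃ n, τ n A}
  empty : ∃ n, τ n (∅ : Set X)
  univ : ∃ n, τ n (Set.univ : Set X)
  malcev : ∃ F : ℕ →. ℕ, Nat.Partrec F ∧ ∀ n A, τ n A → ∃ e ∈ F n, SemiDecName ν A e
  union : ∃ U : ℕ →. ℕ, Nat.Partrec U ∧
    (∀ c (s : ℕ → ℕ) (A : ℕ → Set X), (∀ k, s k ∈ phi c k) → (∀ k, τ (s k) (A k)) →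
      ∃ u ∈ U c, τ u (⋃ k, A k) ∧ ∀ k, r (s k) u) ∧
    (∀ c (s : ℕ → ℕ) (A : ℕ → Set X) c' (s' : ℕ → ℕ) (A' : ℕ → Set X),
      (∀ k, s k ∈ phi c k) → (∀ k, τ (s k) (A k)) →
      (∀ k, s' k ∈ phi c' k) → (∀ k, τ (s' k) (A' k)) →
      (∀ p, SeqIncl r (s p) s') →
      ∀ u ∈ U c, ∀ u' ∈ U c', r u u')
  inter : ∃ I : ℕ →. ℕ, Nat.Partrec I ∧
    (∀ n₁ n₂ A₁ A₂, τ n₁ A₁ → τ n₂ A₂ → ∃ u ∈ I (Nat.pair n₁ n₂), τ u (A₁ ∩ A₂)) ∧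
    (∀ n₁ n₂ A₁ A₂ n₁' n₂' A₁' A₂', τ n₁ A₁ → τ n₂ A₂ → τ n₁' A₁' → τ n₂' A₂' →
      r n₁ n₁' → r n₂ n₂' →
      ∀ u ∈ I (Nat.pair n₁ n₂), ∀ u' ∈ I (Nat.pair n₁' n₂'), r u u')

/-- A Type 1 computable topological space with the actual inclusion relation as
formal inclusion (all monotonicity requirements are then automatic and omitted). -/
structure IsCTSIncl {X : Type*} (ν : ℕ →. X) (T : TopologicalSpace X)
    (τ : ℕ → Set X → Prop) : Prop where
  single : ∀ n A B, τ n A → τ n B → A = B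
  isOpen : ∀ n A, τ n A → T.IsOpen A
  generates : T = TopologicalSpace.generateFrom {A | ∃ n, τ n A}
  empty : ∃ n, τ n (∅ : Set X)
  univ : ∃ n, τ n (Set.univ : Set X)
  malcev : ∃ F : ℕ →. ℕ, Nat.Partrec F ∧ ∀ n A, τ n A → ∃ e ∈ F n, SemiDecName ν A e
  union : ∃ U : ℕ →. ℕ, Nat.Partrec U ∧
    ∀ c (s : ℕ → ℕ) (A : ℕ → Set X), (∀ k, s k ∈ phi c k) → (∀ k, τ (s k) (A k)) →
      ∃ u ∈ U c, τ u (⋃ k, A k)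
  inter : ∃ I : ℕ →. ℕ, Nat.Partrec I ∧
    ∀ n₁ n₂ A₁ A₂, τ n₁ A₁ → τ n₂ A₂ → ∃ u ∈ I (Nat.pair n₁ n₂), τ u (A₁ ∩ A₂)

/-- A Nogina basis for `(X, ν)` (with `ν` intended to be a numbering, i.e. onto). -/
structure IsNoginaBasis {X : Type*} (ν : ℕ →. X) (β : ℕ → Set X → Prop) : Prop where
  single : ∀ b B B', β b B → β b B' → B = B'
  semidec : ∃ F : ℕ →. ℕ, Nat.Partrec F ∧ ∀ b B, β b B → ∃ e ∈ F b, SemiDecName ν B e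
  point : ∃ G : ℕ →. ℕ, Nat.Partrec G ∧
    ∀ n x, x ∈ ν n → ∃ b ∈ G n, ∃ B, β b B ∧ x ∈ B
  inter : ∃ H : ℕ →. ℕ, Nat.Partrec H ∧
    ∀ b₁ b₂ B₁ B₂ n x, β b₁ B₁ → β b₂ B₂ → x ∈ ν n → x ∈ B₁ → x ∈ B₂ →
      ∃ b₃ ∈ H (Nat.pair (Nat.pair b₁ b₂) n), ∃ B₃, β b₃ B₃ ∧ x ∈ B₃ ∧ B₃ ⊆ B₁ ∩ B₂

/-- `p = ⟨e₁, e₂⟩` is a name of the open set `O` for the Nogina topology of the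
basis `β`: `e₁` witnesses semi-decidability of `O` and `e₂` computes, from a
`ν`-name of a point of `O`, a basic set containing the point and contained in `O`. -/
def NoginaName {X : Type*} (ν : ℕ →. X) (β : ℕ → Set X → Prop) (p : ℕ) (O : Set X) : Prop :=
  SemiDecName ν O p.unpair.1 ∧
  ∀ n x, x ∈ ν n → x ∈ O → ∃ b ∈ phi p.unpair.2 n, ∃ B, β b B ∧ x ∈ B ∧ B ⊆ O

/-- `i` is a name of `O` as a Lacombe set: `W i ⊆ dom β` and `O` is the union of
the basic sets named by elements of `W i`. -/
def LacombeName {X : Type*} (β : ℕ → Set X → Prop) (i : ℕ) (O : Set X) : Prop :=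
  (∀ k ∈ W i, ∃ B, β k B) ∧ O = ⋃ k ∈ W i, ⋃ B, ⋃ (_ : β k B), B

/-- A Lacombe basis for `(X, ν)`. -/
structure IsLacombeBasis {X : Type*} (ν : ℕ →. X) (β : ℕ → Set X → Prop) : Prop where
  single : ∀ b B B', β b B → β b B' → B = B'
  semidec : ∃ F : ℕ →. ℕ, Nat.Partrec F ∧ ∀ b B, β b B → ∃ e ∈ F b, SemiDecName ν B e
  point : ∀ x : X, ∃ b B, β b B ∧ x ∈ B
  cover : ∃ i, LacombeName β i (Set.univ : Set X)
  inter : ∃ H : ℕ →. ℕ, Nat.Partrec H ∧ ∀ b₁ b₂ B₁ B₂, β b₁ B₁ → β b₂ B₂ →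
    ∃ i ∈ H (Nat.pair b₁ b₂), LacombeName β i (B₁ ∩ B₂)

/-- A Spreen basis for `(X, ν)`, with formal inclusion relation `r`.  Computable
functions with values in `dom(β)^ℕ` are represented by partial computable
functions producing the `k`-th term of the sequence from the pair `⟨input, k⟩`. -/
structure IsSpreenBasis {X : Type*} (ν : ℕ →. X) (β : ℕ → Set X → Prop)
    (r : ℕ → ℕ → Prop) : Prop where
  single : ∀ b B B', β b B → β b B' → B = B'
  formal : IsFormalIncl β r
  semidec : ∃ F : ℕ →. ℕ, Nat.Partrec F ∧ ∀ b B, β b B → ∃ e ∈ F b, SemiDecName ν B e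
  dense : ∀ b B, β b B → B.Nonempty → ∃ n x, x ∈ ν n ∧ x ∈ B
  G1 : ∃ g : ℕ →. ℕ, Nat.Partrec g ∧
    (∀ n x, x ∈ ν n → ∃ s : ℕ → ℕ, (∀ k, s k ∈ g (Nat.pair n k)) ∧
      ∀ k, ∃ B, β (s k) B ∧ x ∈ B) ∧
    (∀ n m x (s t : ℕ → ℕ), x ∈ ν n → x ∈ ν m →
      (∀ k, s k ∈ g (Nat.pair n k)) → (∀ k, t k ∈ g (Nat.pair m k)) → SeqEquiv r s t) ∧
    (∀ x : X, ∃ b B, β b B ∧ x ∈ B ∧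
      ∀ n y, y ∈ ν n → y ∈ B → ∀ s : ℕ → ℕ, (∀ k, s k ∈ g (Nat.pair n k)) → SeqIncl r b s)
  G2 : ∃ g : ℕ →. ℕ, Nat.Partrec g ∧
    (∀ n x b₁ b₂ B₁ B₂, x ∈ ν n → β b₁ B₁ → β b₂ B₂ → x ∈ B₁ → x ∈ B₂ →
      ∃ s : ℕ → ℕ, (∀ k, s k ∈ g (Nat.pair (Nat.pair n (Nat.pair b₁ b₂)) k)) ∧
        ∀ k, ∃ B, β (s k) B ∧ x ∈ B ∧ B ⊆ B₁ ∩ B₂) ∧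
    (∀ n m x b₁ b₂ b₁' b₂' (s t : ℕ → ℕ), x ∈ ν n → x ∈ ν m → r b₁ b₁' → r b₂ b₂' →
      (∀ k, s k ∈ g (Nat.pair (Nat.pair n (Nat.pair b₁ b₂)) k)) →
      (∀ k, t k ∈ g (Nat.pair (Nat.pair m (Nat.pair b₁' b₂')) k)) → SeqIncl₂ r s t) ∧
    (∀ b₁ b₂ B₁ B₂, β b₁ B₁ → β b₂ B₂ → ∀ x, x ∈ B₁ → x ∈ B₂ →
      ∃ b₃ B₃, β b₃ B₃ ∧ x ∈ B₃ ∧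
        ∀ m y, y ∈ ν m → y ∈ B₃ → ∀ s : ℕ → ℕ,
          (∀ k, s k ∈ g (Nat.pair (Nat.pair m (Nat.pair b₁ b₂)) k)) → SeqIncl r b₃ s)

/-- `p = ⟨n, m⟩` is a name of the open set `O` for the Spreen topology of the
Spreen basis `(β, r)`. -/
def SpreenName {X : Type*} (ν : ℕ →. X) (β : ℕ → Set X → Prop) (r : ℕ → ℕ → Prop)
    (p : ℕ) (O : Set X) : Prop :=
  SemiDecName ν O p.unpair.1 ∧
  (∀ n x, x ∈ ν n → x ∈ O → ∃ s : ℕ → ℕ,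
      (∀ k, s k ∈ phi p.unpair.2 (Nat.pair n k)) ∧
      ∀ k, ∃ B, β (s k) B ∧ x ∈ B ∧ B ⊆ O) ∧
  (∀ n m x (s t : ℕ → ℕ), x ∈ ν n → x ∈ ν m → x ∈ O →
      (∀ k, s k ∈ phi p.unpair.2 (Nat.pair n k)) →
      (∀ k, t k ∈ phi p.unpair.2 (Nat.pair m k)) → SeqEquiv r s t) ∧
  (∀ x, x ∈ O → ∃ b B, β b B ∧ x ∈ B ∧
      ∀ n y, y ∈ ν n → y ∈ B → ∀ s : ℕ → ℕ,
        (∀ k, s k ∈ phi p.unpair.2 (Nat.pair n k)) → SeqIncl r b s)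

/-- The extension of the formal inclusion relation `r` to names of Spreen open sets. -/
def SpreenTauIncl {X : Type*} (ν : ℕ →. X) (r : ℕ → ℕ → Prop) (p q : ℕ) : Prop :=
  ∀ n ∈ ν.Dom, (phi p.unpair.1 n).Dom →
    (phi q.unpair.1 n).Dom ∧
    ∀ s t : ℕ → ℕ, (∀ k, s k ∈ phi p.unpair.2 (Nat.pair n k)) →
      (∀ k, t k ∈ phi q.unpair.2 (Nat.pair n k)) → SeqIncl₂ r s t

/-- A partial computable translation of Spreen names of open sets for the basis
`(β₁, r₁)` into Spreen names for the basis `(β₂, r₂)`, increasing with respect to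
the extended formal inclusion relations. -/
def SpreenTopTrans {X : Type*} (ν : ℕ →. X) (β₁ : ℕ → Set X → Prop) (r₁ : ℕ → ℕ → Prop)
    (β₂ : ℕ → Set X → Prop) (r₂ : ℕ → ℕ → Prop) : Prop :=
  ∃ h : ℕ →. ℕ, Nat.Partrec h ∧
    (∀ p O, SpreenName ν β₁ r₁ p O → ∃ q ∈ h p, SpreenName ν β₂ r₂ q O) ∧
    (∀ p p' O O', SpreenName ν β₁ r₁ p O → SpreenName ν β₁ r₁ p' O' →
      SpreenTauIncl ν r₁ p p' → ∀ q ∈ h p, ∀ q' ∈ h p', SpreenTauIncl ν r₂ q q')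

/-- Effective continuity between computable topological spaces, with the actual
inclusion relations as formal inclusions. -/
def EffContinuous {X Y : Type*} (T₁ : TopologicalSpace X) (T₂ : TopologicalSpace Y)
    (τ₁ : ℕ → Set X → Prop) (τ₂ : ℕ → Set Y → Prop) (f : X → Y) : Prop :=
  (@Continuous X Y T₁ T₂ f) ∧
  ∃ h : ℕ →. ℕ, Nat.Partrec h ∧ ∀ n O, τ₂ n O → ∃ m ∈ h n, τ₁ m (f ⁻¹' O)

/-- Effective continuity between computable topological spaces with formal
inclusion relations `r₁`, `r₂` on names of open sets. -/
def EffContinuousF {X Y : Type*} (T₁ : TopologicalSpace X) (T₂ : TopologicalSpace Y)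
    (τ₁ : ℕ → Set X → Prop) (τ₂ : ℕ → Set Y → Prop)
    (r₁ r₂ : ℕ → ℕ → Prop) (f : X → Y) : Prop :=
  (@Continuous X Y T₁ T₂ f) ∧
  ∃ h : ℕ →. ℕ, Nat.Partrec h ∧
    (∀ n O, τ₂ n O → ∃ m ∈ h n, τ₁ m (f ⁻¹' O)) ∧
    (∀ n₁ n₂ O₁ O₂, τ₂ n₁ O₁ → τ₂ n₂ O₂ → r₂ n₁ n₂ →
      ∀ m₁ ∈ h n₁, ∀ m₂ ∈ h n₂, r₁ m₁ m₂)

/-- `e` is a Cauchy name (`c_ℝ`-name) of the real number `x`. -/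
def CRealName (e : ℕ) (x : ℝ) : Prop :=
  ∀ n : ℕ, ∃ m ∈ phi e n, |((ratOfNat m : ℚ) : ℝ) - x| < (2 : ℝ) ^ (-(n : ℤ))

/-- `e` is a left (lower) name (`c_↗`-name) of the real number `x`: it computes a
nondecreasing sequence of rationals below `x` converging to `x`. -/
def LRealName (e : ℕ) (x : ℝ) : Prop :=
  ∃ s : ℕ → ℕ, (∀ n, s n ∈ phi e n) ∧
    (Monotone fun n => ratOfNat (s n)) ∧
    (∀ n, ((ratOfNat (s n) : ℚ) : ℝ) < x) ∧
    Filter.Tendsto (fun n => ((ratOfNat (s n) : ℚ) : ℝ)) Filter.atTop (nhds x)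

/-- `(X, ν, d)` is a (non-necessarily effectively separable) computable metric
space: the computable points are dense and the metric is `(ν×ν, c_ℝ)`-computable. -/
structure IsCMS {X : Type*} [MetricSpace X] (ν : ℕ →. X) : Prop where
  dense : Dense {x : X | ∃ n, x ∈ ν n}
  dist_comp : ∃ F : ℕ →. ℕ, Nat.Partrec F ∧
    ∀ n m x y, x ∈ ν n → y ∈ ν m → ∃ e ∈ F (Nat.pair n m), CRealName e (dist x y)

/-- The natural numbering of the open balls of a computable metric space, centered
at computable points with computable radii: `⟨n, m⟩` names `B(ν n, c_ℝ m)`. -/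
def ballName {X : Type*} [MetricSpace X] (ν : ℕ →. X) (p : ℕ) (B : Set X) : Prop :=
  ∃ x r, x ∈ ν p.unpair.1 ∧ CRealName p.unpair.2 r ∧ B = Metric.ball x r

/-- The natural formal inclusion relation on names of balls:
`(x, r₁) ⊆̊ (y, r₂)` iff `d(x, y) + r₁ ≤ r₂`. -/
def ballIncl {X : Type*} [MetricSpace X] (ν : ℕ →. X) (p q : ℕ) : Prop :=
  ∃ x y r s, x ∈ ν p.unpair.1 ∧ y ∈ ν q.unpair.1 ∧
    CRealName p.unpair.2 r ∧ CRealName q.unpair.2 s ∧ dist x y + r ≤ s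

/-- `f` is effectively metric continuous: from a name of a point `x` and a name of
`ε > 0` one can compute a name of some `η > 0` witnessing continuity at `x`. -/
def EffMetricContinuous {X Y : Type*} [MetricSpace X] [MetricSpace Y]
    (ν : ℕ →. X) (f : X → Y) : Prop :=
  ∃ H : ℕ →. ℕ, Nat.Partrec H ∧
    ∀ n x e ε, x ∈ ν n → CRealName e ε → (0:ℝ) < ε →
      ∃ m ∈ H (Nat.pair n e), ∃ η : ℝ, CRealName m η ∧ 0 < η ∧
        ∀ y : X, dist x y < η → dist (f x) (f y) < ε

/-- `(X, ν, d)` admits an algorithm of passage to the limit. -/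
def HasLimitAlg {X : Type*} [MetricSpace X] (ν : ℕ →. X) : Prop :=
  ∃ L : ℕ →. ℕ, Nat.Partrec L ∧
    ∀ c (s : ℕ → ℕ) (xs : ℕ → X) (x : X),
      (∀ k, s k ∈ phi c k) → (∀ k, xs k ∈ ν (s k)) →
      (∀ k m, k < m → dist (xs k) (xs m) < (2 : ℝ) ^ (-(k : ℤ))) →
      Filter.Tendsto xs Filter.atTop (nhds x) →
      ∃ p ∈ L c, x ∈ ν p


theorem phi_partrec₂ : Partrec₂ phi :=
  Nat.Partrec.Code.eval_part.comp ((Computable.ofNat _).comp Computable.fst) Computable.snd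

/-- The domain of a partial computable function, projected along its last argument, is
computably enumerable, uniformly in the first argument. -/
theorem exists_index_projection {f : (ℕ × ℕ) × ℕ →. ℕ} (hf : Partrec f) :
    ∃ F : ℕ → ℕ, Computable F ∧ ∀ n x, (phi (F n) x).Dom ↔ ∃ k, (f ((n, x), k)).Dom := by
  have hf' : Nat.Partrec fun a => f ((a.unpair.1.unpair.1, a.unpair.1.unpair.2), a.unpair.2) := by
    refine Partrec.nat_iff.1 ?_
    have hu : Computable Nat.unpair := Primrec.unpair.to_comp
    have h1 := hu.comp (Computable.fst.comp hu)
    exact hf.comp (((Computable.fst.comp h1).pair (Computable.snd.comp h1)).pair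
      (Computable.snd.comp hu))
  obtain ⟨c, hc⟩ := Nat.Partrec.Code.exists_code.1 hf'
  let search : ℕ → ℕ → Option ℕ := fun a t =>
    Nat.Partrec.Code.evaln t.unpair.2 c (Nat.pair a t.unpair.1)
  have hsearch : Computable₂ search := by
    have hu : Computable fun p : ℕ × ℕ => p.2.unpair := Primrec.unpair.to_comp.comp Computable.snd
    exact Nat.Partrec.Code.primrec_evaln.to_comp.comp
      (((Computable.snd.comp hu).pair (Computable.const c)).pair
        (Primrec₂.natPair.to_comp.comp Computable.fst (Computable.fst.comp hu)))
  obtain ⟨d, hd⟩ := Nat.Partrec.Code.exists_code.1 (Partrec.nat_iff.1 (Partrec.rfindOpt hsearch))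
  refine ⟨fun n => Encodable.encode (d.curry n), Computable.encode.comp
    (Nat.Partrec.Code.primrec₂_curry.to_comp.comp (Computable.const d) Computable.id), ?_⟩
  intro n x
  rw [phi, Denumerable.ofNat_encode, Nat.Partrec.Code.eval_curry, hd, Nat.rfindOpt_dom]
  have key : ∀ k, f ((n, x), k) = c.eval (Nat.pair (Nat.pair n x) k) := by
    intro k
    simp [hc]
  simp only [key, Part.dom_iff_mem, Nat.Partrec.Code.evaln_complete, search]
  constructor
  · rintro ⟨t, y, hy⟩
    exact ⟨t.unpair.1, y, t.unpair.2, hy⟩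
  · rintro ⟨k, y, m, hy⟩
    exact ⟨Nat.pair k m, y, by simpa using hy⟩

section LacombeTopology

variable {X : Type*} {ν : ℕ →. X} {β : ℕ → Set X → Prop} {i : ℕ} {O : Set X}

theorem LacombeName.mem_iff (h : LacombeName β i O) {x : X} :
    x ∈ O ↔ ∃ k ∈ W i, ∃ B, β k B ∧ x ∈ B := by
  rw [h.2]
  simp

theorem lacombeName_of_mem_iff (hdom : ∀ k ∈ W i, ∃ B, β k B)
    (hmem : ∀ x, x ∈ O ↔ ∃ k ∈ W i, ∃ B, β k B ∧ x ∈ B) : LacombeName β i O := by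
  refine ⟨hdom, Set.ext fun x => ?_⟩
  rw [hmem]
  simp

theorem exists_lacombeName_empty (β : ℕ → Set X → Prop) : ∃ i, LacombeName β i ∅ := by
  obtain ⟨F, -, hF⟩ := exists_index_projection (f := fun _ => Part.none) Partrec.none
  have hW : ∀ k, k ∉ W (F 0) := fun k hk => by simpa using (hF 0 k).1 hk
  exact ⟨F 0, lacombeName_of_mem_iff (fun k hk => (hW k hk).elim) (by simp [hW])⟩

theorem exists_lacombeName_basic (hβ : IsLacombeBasis ν β) {b : ℕ} {B : Set X} (hB : β b B) :
    ∃ i, LacombeName β i B := by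
  obtain ⟨H, -, hH⟩ := hβ.inter
  obtain ⟨i, -, hi⟩ := hH b b B B hB hB
  exact ⟨i, by simpa using hi⟩

theorem LacombeName.isOpen (h : LacombeName β i O) :
    (TopologicalSpace.generateFrom {B | ∃ b, β b B}).IsOpen O := by
  let := TopologicalSpace.generateFrom {B | ∃ b, β b B}
  change IsOpen O
  rw [h.2]
  refine isOpen_iUnion fun k => isOpen_iUnion fun _ =>
    isOpen_iUnion fun B => isOpen_iUnion fun hB => ?_
  exact TopologicalSpace.isOpen_generateFrom_of_mem ⟨k, hB⟩

theorem generateFrom_lacombeName (hβ : IsLacombeBasis ν β) :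
    TopologicalSpace.generateFrom {B | ∃ b, β b B} =
      TopologicalSpace.generateFrom {A | ∃ n, LacombeName β n A} := by
  apply le_antisymm
  · exact le_generateFrom fun A ⟨_, hA⟩ => hA.isOpen
  · exact TopologicalSpace.generateFrom_anti fun B ⟨_, hB⟩ => exists_lacombeName_basic hβ hB

theorem lacombeName_malcev (hβ : IsLacombeBasis ν β) :
    ∃ F : ℕ →. ℕ, Nat.Partrec F ∧ ∀ n A, LacombeName β n A → ∃ e ∈ F n, SemiDecName ν A e := by
  obtain ⟨S, hS, hS'⟩ := hβ.semidec
  let f : (ℕ × ℕ) × ℕ →. ℕ := fun a =>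
    (phi a.1.1 a.2).bind fun _ => (S a.2).bind fun e => phi e a.1.2
  have hf : Partrec f := by
    refine (phi_partrec₂.comp (Computable.fst.comp Computable.fst) Computable.snd).bind
      (Partrec.bind ((Partrec.nat_iff.2 hS).comp (Computable.snd.comp Computable.fst))
        (phi_partrec₂.comp Computable.snd ?_))
    exact Computable.snd.comp (Computable.fst.comp (Computable.fst.comp Computable.fst))
  obtain ⟨F, hF, hF'⟩ := exists_index_projection hf
  refine ⟨F, Partrec.nat_iff.1 hF.partrec, fun n A hA => ⟨F n, Part.mem_some _, ?_⟩⟩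
  intro j x hx
  rw [hF', hA.mem_iff]
  simp only [f, Part.bind_dom]
  constructor
  · rintro ⟨k, hk, he, hd⟩
    obtain ⟨B, hB⟩ := hA.1 k hk
    obtain ⟨e, heS, hsd⟩ := hS' k B hB
    rw [Part.get_eq_of_mem heS] at hd
    exact ⟨k, hk, B, hB, (hsd j x hx).1 hd⟩
  · rintro ⟨k, hk, B, hB, hxB⟩
    obtain ⟨e, heS, hsd⟩ := hS' k B hB
    refine ⟨k, hk, Part.dom_iff_mem.2 ⟨e, heS⟩, ?_⟩
    rw [Part.get_eq_of_mem heS]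
    exact (hsd j x hx).2 hxB

theorem lacombeName_union (β : ℕ → Set X → Prop) :
    ∃ U : ℕ →. ℕ, Nat.Partrec U ∧
      ∀ c (s : ℕ → ℕ) (A : ℕ → Set X), (∀ k, s k ∈ phi c k) → (∀ k, LacombeName β (s k) (A k)) →
        ∃ u ∈ U c, LacombeName β u (⋃ k, A k) := by
  let f : (ℕ × ℕ) × ℕ →. ℕ := fun a => (phi a.1.1 a.2).bind fun e => phi e a.1.2
  have hf : Partrec f :=
    (phi_partrec₂.comp (Computable.fst.comp Computable.fst) Computable.snd).bind
      (phi_partrec₂.comp Computable.snd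
        (Computable.snd.comp (Computable.fst.comp Computable.fst)))
  obtain ⟨F, hF, hF'⟩ := exists_index_projection hf
  refine ⟨F, Partrec.nat_iff.1 hF.partrec, fun c s A hs hA => ⟨F c, Part.mem_some _, ?_⟩⟩
  have hW : ∀ x, x ∈ W (F c) ↔ ∃ k, x ∈ W (s k) := by
    intro x
    refine (hF' c x).trans (exists_congr fun k => ?_)
    simp only [f, Part.eq_some_iff.2 (hs k), Part.bind_some]
    rfl
  refine lacombeName_of_mem_iff (fun x hx => ?_) fun x => ?_
  · obtain ⟨k, hk⟩ := (hW x).1 hx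
    exact (hA k).1 x hk
  · simp only [Set.mem_iUnion, (hA _).mem_iff, hW]
    constructor
    · rintro ⟨k, b, hb, hB⟩
      exact ⟨b, ⟨k, hb⟩, hB⟩
    · rintro ⟨b, ⟨k, hb⟩, hB⟩
      exact ⟨k, b, hb, hB⟩

theorem lacombeName_inter (hβ : IsLacombeBasis ν β) :
    ∃ I : ℕ →. ℕ, Nat.Partrec I ∧
      ∀ n₁ n₂ A₁ A₂, LacombeName β n₁ A₁ → LacombeName β n₂ A₂ →
        ∃ u ∈ I (Nat.pair n₁ n₂), LacombeName β u (A₁ ∩ A₂) := by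
  obtain ⟨H, hH, hH'⟩ := hβ.inter
  let f : (ℕ × ℕ) × ℕ →. ℕ := fun a =>
    (phi a.1.1.unpair.1 a.2.unpair.1).bind fun _ =>
      (phi a.1.1.unpair.2 a.2.unpair.2).bind fun _ => (H a.2).bind fun i => phi i a.1.2
  have hf : Partrec f := by
    have hu : Computable Nat.unpair := Primrec.unpair.to_comp
    have hn : Computable fun a : (ℕ × ℕ) × ℕ => a.1.1.unpair :=
      hu.comp (Computable.fst.comp Computable.fst)
    have hk : Computable fun a : (ℕ × ℕ) × ℕ => a.2.unpair := hu.comp Computable.snd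
    refine (phi_partrec₂.comp (Computable.fst.comp hn) (Computable.fst.comp hk)).bind
      (Partrec.bind (phi_partrec₂.comp ((Computable.snd.comp hn).comp Computable.fst)
        ((Computable.snd.comp hk).comp Computable.fst))
        (Partrec.bind ((Partrec.nat_iff.2 hH).comp
          (Computable.snd.comp (Computable.fst.comp Computable.fst)))
          (phi_partrec₂.comp Computable.snd ?_)))
    exact (Computable.snd.comp Computable.fst).comp
      (Computable.fst.comp (Computable.fst.comp Computable.fst))
  obtain ⟨F, hF, hF'⟩ := exists_index_projection hf
  refine ⟨F, Partrec.nat_iff.1 hF.partrec, fun n₁ n₂ A₁ A₂ h₁ h₂ => ⟨_, Part.mem_some _, ?_⟩⟩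
  have hW : ∀ x, x ∈ W (F (Nat.pair n₁ n₂)) ↔
      ∃ b₁ ∈ W n₁, ∃ b₂ ∈ W n₂, ∃ i ∈ H (Nat.pair b₁ b₂), x ∈ W i := by
    intro x
    refine (hF' _ x).trans ?_
    simp only [f, Part.bind_dom, Nat.unpair_pair]
    constructor
    · rintro ⟨k, hk₁, hk₂, hi, hx⟩
      exact ⟨_, hk₁, _, hk₂, _, by simpa using Part.get_mem hi, hx⟩
    · rintro ⟨b₁, hb₁, b₂, hb₂, i, hi, hx⟩
      refine ⟨Nat.pair b₁ b₂, ?_⟩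
      simp only [Nat.unpair_pair]
      refine ⟨hb₁, hb₂, Part.dom_iff_mem.2 ⟨i, hi⟩, ?_⟩
      rw [Part.get_eq_of_mem hi]
      exact hx
  have hname : ∀ b₁ ∈ W n₁, ∀ b₂ ∈ W n₂, ∀ i ∈ H (Nat.pair b₁ b₂), ∃ B₁ B₂,
      β b₁ B₁ ∧ β b₂ B₂ ∧ LacombeName β i (B₁ ∩ B₂) := by
    intro b₁ hb₁ b₂ hb₂ i hi
    obtain ⟨B₁, hB₁⟩ := h₁.1 b₁ hb₁
    obtain ⟨B₂, hB₂⟩ := h₂.1 b₂ hb₂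
    obtain ⟨j, hj, hname⟩ := hH' b₁ b₂ B₁ B₂ hB₁ hB₂
    exact ⟨B₁, B₂, hB₁, hB₂, Part.mem_unique hj hi ▸ hname⟩
  refine lacombeName_of_mem_iff (fun x hx => ?_) fun x => ?_
  · obtain ⟨b₁, hb₁, b₂, hb₂, i, hi, hxi⟩ := (hW x).1 hx
    obtain ⟨B₁, B₂, -, -, h⟩ := hname b₁ hb₁ b₂ hb₂ i hi
    exact h.1 x hxi
  · rw [Set.mem_inter_iff, h₁.mem_iff, h₂.mem_iff]
    constructor
    · rintro ⟨⟨b₁, hb₁, B₁, hB₁, hx₁⟩, b₂, hb₂, B₂, hB₂, hx₂⟩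
      obtain ⟨i, hi, h⟩ := hH' b₁ b₂ B₁ B₂ hB₁ hB₂
      obtain ⟨b, hb, hB⟩ := h.mem_iff.1 ⟨hx₁, hx₂⟩
      exact ⟨b, (hW b).2 ⟨b₁, hb₁, b₂, hb₂, i, hi, hb⟩, hB⟩
    · rintro ⟨b, hb, hB⟩
      obtain ⟨b₁, hb₁, b₂, hb₂, i, hi, hbi⟩ := (hW b).1 hb
      obtain ⟨B₁, B₂, hB₁, hB₂, h⟩ := hname b₁ hb₁ b₂ hb₂ i hi
      obtain ⟨hx₁, hx₂⟩ := h.mem_iff.2 ⟨b, hbi, hB⟩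
      exact ⟨⟨b₁, hb₁, B₁, hB₁, hx₁⟩, b₂, hb₂, B₂, hB₂, hx₂⟩

end LacombeTopology

/-- If `ν` is a subnumbering of `X` and `(ℬ, β)` is a Lacombe
basis for `(X, ν)`, then the associated Lacombe topology, with the actual inclusion
as formal inclusion, is a Type 1 computable topological space. -/
theorem lacombe_topology_isCTS {X : Type*} (ν : ℕ →. X)
    (β : ℕ → Set X → Prop) (hβ : IsLacombeBasis ν β) :
    IsCTSIncl ν (TopologicalSpace.generateFrom {B | ∃ b, β b B}) (LacombeName β) := by
  exact
    { single := fun n A B hA hB => hA.2.trans hB.2.symm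
      isOpen := fun n A hA => hA.isOpen
      generates := generateFrom_lacombeName hβ
      empty := exists_lacombeName_empty β
      univ := hβ.cover
      malcev := lacombeName_malcev hβ
      union := lacombeName_union β
      inter := lacombeName_inter hβ }

end T1
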